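/- Let A be a unital C*-algebra, let f ∈ A be a self-adjoint element, and let ε > 0. Then there exist n ∈ ℕ, δ > 0, and self-adjoint elements f_1, f_2, ..., f_n ∈ A such that: (1) ‖f − f_i‖ < ε for each i = 1, ..., n; and (2) (1/n) · ( τ(χ_δ(f_1)) + ... + τ(χ_δ(f_n)) ) < ε for every tracial state τ on A. -/

import Mathlib

open scoped ComplexOrder

/-- The cutoff function `χ_δ : ℝ → [0,1]`: equal to `1` for `|t| ≤ δ/2`, `0` for
`|t| ≥ δ`, and linear in between. -/
noncomputable def chiCutoff (δ t : ℝ) : ℝ :=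
  max 0 (min 1 (2 - 2 * |t| / δ))

theorem chiCutoff_le_one (δ t : ℝ) : chiCutoff δ t ≤ 1 :=
  max_le zero_le_one (min_le_left _ _)

theorem continuous_chiCutoff (δ : ℝ) : Continuous (chiCutoff δ) := by
  unfold chiCutoff
  fun_prop

theorem chiCutoff_eq_zero {δ t : ℝ} (hδ : 0 < δ) (ht : δ ≤ |t|) : chiCutoff δ t = 0 := by
  refine max_eq_left ((min_le_right _ _).trans ?_)
  rw [sub_nonpos, le_div_iff₀ hδ]
  linarith

/-- Translates of the cutoff function along a `2δ`-separated family sum to at most `1`. -/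
theorem sum_chiCutoff_sub_le_one {ι : Type*} [Fintype ι] {δ : ℝ} (hδ : 0 < δ) (t : ι → ℝ)
    (ht : ∀ i j, i ≠ j → 2 * δ ≤ |t i - t j|) (x : ℝ) :
    ∑ i, chiCutoff δ (x - t i) ≤ 1 := by
  by_cases h : ∃ i, |x - t i| < δ
  · obtain ⟨i, hi⟩ := h
    rw [Finset.sum_eq_single i]
    · exact chiCutoff_le_one _ _
    · intro j _ hji
      refine chiCutoff_eq_zero hδ ?_
      have h₁ := ht j i hji
      have h₂ : |t j - t i| ≤ |x - t i| + |x - t j| := by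
        have := abs_sub (x - t i) (x - t j)
        rwa [sub_sub_sub_cancel_left] at this
      linarith
    · simp
  · push Not at h
    rw [Finset.sum_eq_zero fun i _ => chiCutoff_eq_zero hδ (h i)]
    exact zero_le_one

/-- A positive functional is nonnegative on `cfc g f` whenever `g` is continuous and nonnegative. -/
theorem map_cfc_nonneg_of_forall_star_mul_self {A : Type*} [CStarAlgebra A] (f : A)
    (τ : A →ₗ[ℂ] ℂ) (hτ : ∀ a : A, 0 ≤ τ (star a * a)) {g : ℝ → ℝ} (hg : Continuous g)
    (hg₀ : ∀ x, 0 ≤ g x) : 0 ≤ τ (cfc g f) := by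
  have h := hτ (cfc (fun x => √(g x)) f)
  rw [← cfc_star, ← cfc_mul _ _ f (by fun_prop) (by fun_prop)] at h
  simpa only [star_trivial, Real.mul_self_sqrt (hg₀ _)] using h

theorem norm_sub_cfc_sub_const_le {A : Type*} [CStarAlgebra A] (f : A) (hf : IsSelfAdjoint f)
    (t : ℝ) : ‖f - cfc (fun x : ℝ => x - t) f‖ ≤ |t| := by
  nth_rewrite 1 [← cfc_id' ℝ f]
  rw [← cfc_sub _ _ f (by fun_prop) (by fun_prop)]
  exact norm_cfc_le (abs_nonneg t) fun x _ => by simp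

theorem approx_selfadjoint_with_small_cutoff_traces
    {A : Type*} [CStarAlgebra A]
    (f : A) (hf : IsSelfAdjoint f) (ε : ℝ) (hε : 0 < ε) :
    ∃ (n : ℕ) (_ : 0 < n) (δ : ℝ) (_ : 0 < δ) (fs : Fin n → A),
      (∀ i, IsSelfAdjoint (fs i)) ∧
      (∀ i, ‖f - fs i‖ < ε) ∧
      (∀ τ : A →ₗ[ℂ] ℂ,
        (∀ a : A, 0 ≤ τ (star a * a)) → τ 1 = 1 → (∀ a b : A, τ (a * b) = τ (b * a)) →
        (1 / (n : ℂ)) * (∑ i, τ (cfc (chiCutoff δ) (fs i))) < (ε : ℂ)) := by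
  obtain ⟨m, hm⟩ := exists_nat_one_div_lt hε
  obtain ⟨n, hn, hnε⟩ : ∃ n : ℕ, 0 < n ∧ 1 / (n : ℝ) < ε :=
    ⟨m + 1, m.succ_pos, by exact_mod_cast hm⟩
  have hn' : (0 : ℝ) < n := Nat.cast_pos.2 hn
  have hεn : 0 < ε / n := div_pos hε hn'
  set δ : ℝ := ε / n / 2 with hδ_def
  have hδ : 0 < δ := half_pos hεn
  let t : Fin n → ℝ := fun i => ε / n * (i : ℕ)
  have ht : ∀ i j, i ≠ j → 2 * δ ≤ |t i - t j| := by
    intro i j hij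
    have h : (1 : ℝ) ≤ |((i : ℕ) : ℝ) - ((j : ℕ) : ℝ)| := by
      have : (1 : ℤ) ≤ |((i : ℕ) : ℤ) - ((j : ℕ) : ℤ)| :=
        Int.one_le_abs (by have := Fin.val_ne_of_ne hij; omega)
      exact_mod_cast this
    simp only [t]
    rw [← mul_sub, abs_mul, abs_of_pos hεn, hδ_def, mul_div_cancel₀ _ two_ne_zero]
    exact le_mul_of_one_le_right hεn.le h
  refine ⟨n, hn, δ, hδ, fun i => cfc (fun x : ℝ => x - t i) f, fun i => cfc_predicate _ f,
    fun i => (norm_sub_cfc_sub_const_le f hf (t i)).trans_lt ?_, fun τ hτ hτ₁ _ => ?_⟩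
  · have hi : ((i : ℕ) : ℝ) < n := Nat.cast_lt.2 i.isLt
    rw [abs_of_nonneg (by positivity)]
    calc ε / n * (i : ℕ) < ε / n * n := mul_lt_mul_of_pos_left hi hεn
      _ = ε := div_mul_cancel₀ ε hn'.ne'
  · have hcont : ∀ i, Continuous fun x => chiCutoff δ (x - t i) := fun i =>
      (continuous_chiCutoff δ).comp (continuous_sub_right _)
    have hcomp : ∀ i, cfc (chiCutoff δ) (cfc (fun x : ℝ => x - t i) f) =
        cfc (fun x => chiCutoff δ (x - t i)) f := fun i =>
      (cfc_comp' (chiCutoff δ) (fun x : ℝ => x - t i) f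
        (continuous_chiCutoff δ).continuousOn (by fun_prop)).symm
    have hsum : Continuous fun x => ∑ i, chiCutoff δ (x - t i) :=
      continuous_finsetSum _ fun i _ => hcont i
    have hle : ∑ i, τ (cfc (chiCutoff δ) (cfc (fun x : ℝ => x - t i) f)) ≤ 1 := by
      have h := map_cfc_nonneg_of_forall_star_mul_self f τ hτ
        (g := fun x => 1 - ∑ i, chiCutoff δ (x - t i)) (continuous_const.sub hsum) fun x =>
          sub_nonneg.2 (sum_chiCutoff_sub_le_one hδ t ht x)
      rw [cfc_sub _ _ f continuousOn_const hsum.continuousOn, cfc_const_one ℝ f,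
        ← Finset.sum_fn, cfc_sum_univ _ f fun i => (hcont i).continuousOn, map_sub, hτ₁, map_sum, sub_nonneg] at h
      simpa only [hcomp] using h
    have hpos : (0 : ℂ) ≤ 1 / (n : ℂ) := by positivity
    calc 1 / (n : ℂ) * ∑ i, τ (cfc (chiCutoff δ) (cfc (fun x : ℝ => x - t i) f))
        ≤ 1 / (n : ℂ) * 1 := mul_le_mul_of_nonneg_left hle hpos
      _ = ((1 / (n : ℝ) : ℝ) : ℂ) := by push_cast; ring
      _ < (ε : ℂ) := by exact_mod_cast hnε
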